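/- arXiv:1307.3208 — 2 statements merged into one kernel-verified Lean document; each statement's English description precedes it below -/
import Mathlib

section
/- Let k ≥ 1 be an integer, let P_0, P_1 ⊂ ℝ² be 2-dimensional lattice polygons, and suppose that P := conv((P_0 × {0}) ∪ (P_1 × {k})) ⊂ ℝ³ is a full-dimensional smooth lattice polytope. Then P_0 and P_1 have the same number of vertices, and for every edge e_0 of P_0 × {0} there is an edge e_1 of P_1 × {k} such that e_0 and e_1 are parallel and lie in a common facet of P; in particular, the edges of P_0 and P_1 can be paired so that paired edges are parallel with the same primitive outer normal vector in ℤ², i.e., P_0 and P_1 are normally equivalent. -/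
open Set

/-- The real point corresponding to an integer lattice point. -/
def toR {n : ℕ} (v : Fin n → ℤ) : Fin n → ℝ := fun i => (v i : ℝ)

/-- `P` is a lattice polytope: the convex hull of a finite set of integer points. -/
def IsLatticePolytope {n : ℕ} (P : Set (Fin n → ℝ)) : Prop :=
  ∃ S : Finset (Fin n → ℤ), P = convexHull ℝ (toR '' (S : Set (Fin n → ℤ)))

/-- `P` is full-dimensional: its affine span is everything. -/
def IsFullDim {n : ℕ} (P : Set (Fin n → ℝ)) : Prop :=
  affineSpan ℝ P = ⊤

/-- A vertex of `P` is an extreme point of `P`. -/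
def IsVertex {n : ℕ} (P : Set (Fin n → ℝ)) (v : Fin n → ℝ) : Prop :=
  v ∈ Set.extremePoints ℝ P

/-- The segment from `a` to `b` (distinct integer points) is an edge of `P`,
i.e. an exposed face of `P` which is a segment. -/
def IsEdge {n : ℕ} (P : Set (Fin n → ℝ)) (a b : Fin n → ℤ) : Prop :=
  a ≠ b ∧ IsExposed ℝ P (segment ℝ (toR a) (toR b))

/-- The lattice length of an integer vector: the gcd of its entries. -/
def latticeLength {n : ℕ} (v : Fin n → ℤ) : ℕ :=
  Finset.univ.gcd fun i => (v i).natAbs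

/-- The primitive integer vector in the direction of `v`. -/
def primVec {n : ℕ} (v : Fin n → ℤ) : Fin n → ℤ :=
  fun i => v i / (latticeLength v : ℤ)

/-- `P` is smooth at the integer vertex `v`: there are exactly `n` edges through `v`
and the primitive directions of these edges form a `ℤ`-basis of `ℤⁿ`. -/
def SmoothAtVertex {n : ℕ} (P : Set (Fin n → ℝ)) (v : Fin n → ℤ) : Prop :=
  ∃ b : Fin n → (Fin n → ℤ),
    Function.Injective b ∧
    (∀ i, IsEdge P v (b i)) ∧
    (∀ c : Fin n → ℤ, IsEdge P v c →
      ∃ i, segment ℝ (toR v) (toR c) = segment ℝ (toR v) (toR (b i))) ∧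
    IsUnit (Matrix.det (Matrix.of fun i => primVec (b i - v)))

/-- `P` is a full-dimensional smooth lattice polytope. -/
def IsSmoothPolytope {n : ℕ} (P : Set (Fin n → ℝ)) : Prop :=
  IsLatticePolytope P ∧ IsFullDim P ∧
    ∀ v : Fin n → ℤ, IsVertex P (toR v) → SmoothAtVertex P v

/-- Every edge of `P` has lattice length at least `k`. -/
def EdgesAtLeast {n : ℕ} (P : Set (Fin n → ℝ)) (k : ℕ) : Prop :=
  ∀ a b : Fin n → ℤ, IsEdge P a b → k ≤ latticeLength (b - a)

/-- `P` is a Cayley polytope of order `k` with altitude in direction `eᵢ`: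
`P ⊆ {x : 0 ≤ xᵢ ≤ k}` and every vertex of `P` has `i`-th coordinate `0` or `k`. -/
def IsCayley {n : ℕ} (P : Set (Fin n → ℝ)) (k : ℕ) (i : Fin n) : Prop :=
  (∀ x ∈ P, 0 ≤ x i ∧ x i ≤ (k : ℝ)) ∧
  (∀ v : Fin n → ℝ, IsVertex P v → v i = 0 ∨ v i = (k : ℝ))

/-- `P` is canonically positioned: `0` is a vertex and for each `i` there is an
edge of `P` contained in the nonnegative `xᵢ`-coordinate axis. -/
def CanonicallyPositioned {n : ℕ} (P : Set (Fin n → ℝ)) : Prop :=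
  IsVertex P 0 ∧
  ∀ i : Fin n, ∃ a b : Fin n → ℤ, IsEdge P a b ∧
    segment ℝ (toR a) (toR b) ⊆ {x | 0 ≤ x i ∧ ∀ j, j ≠ i → x j = 0}

/-- `F` is a facet of `P`: an exposed face of dimension `n - 1`. -/
def IsFacet {n : ℕ} (P F : Set (Fin n → ℝ)) : Prop :=
  IsExposed ℝ P F ∧ Module.finrank ℝ (affineSpan ℝ F).direction = n - 1

/-- The lattice width of `Q`: the minimum over nonzero integer functionals `φ` of
`max_{x ∈ Q} ⟨φ, x⟩ - min_{x ∈ Q} ⟨φ, x⟩`. -/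
noncomputable def latticeWidth {n : ℕ} (Q : Set (Fin n → ℝ)) : ℝ :=
  ⨅ φ : {φ : Fin n → ℤ // φ ≠ 0},
    (sSup ((fun x => ∑ i, (φ.1 i : ℝ) * x i) '' Q) -
      sInf ((fun x => ∑ i, (φ.1 i : ℝ) * x i) '' Q))

/-- Embedding of the plane `ℝ²` into `ℝ³` at height `c`. -/
def emb (c : ℝ) (x : Fin 2 → ℝ) : Fin 3 → ℝ := Fin.snoc x c

/-- `ν` is a (common) outer normal of the polygon `Q` at the two points `a, b`:
the linear functional `⟨ν, ·⟩` attains its maximum over `Q` at both `a` and `b`. -/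
def IsCommonOuterNormal (Q : Set (Fin 2 → ℝ)) (ν : Fin 2 → ℤ) (a b : Fin 2 → ℤ) : Prop :=
  (∀ x ∈ Q, ∑ i, (ν i : ℝ) * x i ≤ ∑ i, (ν i : ℝ) * (a i : ℝ)) ∧
  (∀ x ∈ Q, ∑ i, (ν i : ℝ) * x i ≤ ∑ i, (ν i : ℝ) * (b i : ℝ))

theorem toR_injective {n : ℕ} : Function.Injective (toR (n := n)) := fun a b h =>
  funext fun i => by simpa [toR] using congrFun h i

/-- The part of a convex hull on which a linear functional attains its maximum `M` is the hull
of the generators with value `M`. -/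
theorem convexHull_sep_eq {n : ℕ} {T : Set (Fin n → ℝ)} {l : (Fin n → ℝ) →L[ℝ] ℝ} {M : ℝ}
    (h : ∀ t ∈ T, l t ≤ M) :
    {x ∈ convexHull ℝ T | l x = M} = convexHull ℝ {t ∈ T | l t = M} := by
  have hM : ∀ x ∈ convexHull ℝ {t ∈ T | l t = M}, l x = M := fun x hx =>
    convexHull_min (fun t ht => ht.2) (convex_hyperplane l.isLinear M) hx
  apply Set.Subset.antisymm
  · have hC : Convex ℝ ({x | l x < M} ∪ convexHull ℝ {t ∈ T | l t = M}) := by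
      have hle : ∀ x ∈ {x | l x < M} ∪ convexHull ℝ {t ∈ T | l t = M}, l x ≤ M := by
        rintro x (hx | hx)
        · exact le_of_lt hx
        · exact (hM x hx).le
      intro x hx y hy a b ha hb hab
      rcases ha.eq_or_lt with rfl | ha
      · obtain rfl : b = 1 := by linarith
        simpa using hy
      rcases hb.eq_or_lt with rfl | hb
      · obtain rfl : a = 1 := by linarith
        simpa using hx
      have hx' := hle x hx
      have hy' := hle y hy
      rcases hx with hx | hx
      · left
        have hx : l x < M := hx
        simp only [Set.mem_ofPred_eq, map_add, map_smul, smul_eq_mul]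
        have : M = a * M + b * M := by rw [← add_mul, hab, one_mul]
        nlinarith [mul_lt_mul_of_pos_left hx ha, mul_le_mul_of_nonneg_left hy' hb.le]
      rcases hy with hy | hy
      · left
        have hy : l y < M := hy
        simp only [Set.mem_ofPred_eq, map_add, map_smul, smul_eq_mul]
        have : M = a * M + b * M := by rw [← add_mul, hab, one_mul]
        nlinarith [mul_lt_mul_of_pos_left hy hb, mul_le_mul_of_nonneg_left hx' ha.le]
      · exact Or.inr (convex_convexHull ℝ _ hx hy ha.le hb.le hab)
    rintro x ⟨hx, hxM⟩
    have hTC : T ⊆ {x | l x < M} ∪ convexHull ℝ {t ∈ T | l t = M} := fun t ht => by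
      rcases (h t ht).lt_or_eq with h' | h'
      · exact Or.inl h'
      · exact Or.inr (subset_convexHull ℝ _ ⟨ht, h'⟩)
    rcases convexHull_min hTC hC hx with h' | h'
    · exact absurd hxM (ne_of_lt h')
    · exact h'
  · exact fun x hx => ⟨convexHull_mono (fun t ht => ht.1) hx, hM x hx⟩

theorem le_of_mem_convexHull {n : ℕ} {T : Set (Fin n → ℝ)} {l : (Fin n → ℝ) →L[ℝ] ℝ} {M : ℝ}
    (h : ∀ t ∈ T, l t ≤ M) {x : Fin n → ℝ} (hx : x ∈ convexHull ℝ T) : l x ≤ M :=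
  convexHull_min h (convex_halfSpace_le l.isLinear M) hx

theorem isExposed_convexHull_sep {n : ℕ} {T : Set (Fin n → ℝ)} {l : (Fin n → ℝ) →L[ℝ] ℝ} {M : ℝ}
    (h : ∀ t ∈ T, l t ≤ M) :
    IsExposed ℝ (convexHull ℝ T) (convexHull ℝ {t ∈ T | l t = M}) := by
  intro hne
  obtain ⟨t, ht, htM⟩ := convexHull_nonempty_iff.1 hne
  refine ⟨l, ?_⟩
  rw [← convexHull_sep_eq h]
  ext x
  refine and_congr_right fun hx => ⟨fun hxM y hy => hxM ▸ le_of_mem_convexHull h hy, fun H => ?_⟩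
  exact le_antisymm (le_of_mem_convexHull h hx) (htM ▸ H t (subset_convexHull ℝ _ ht))

/-- The convex hull of a set of lattice points. -/
def latticeHull {n : ℕ} (S : Set (Fin n → ℤ)) : Set (Fin n → ℝ) := convexHull ℝ (toR '' S)

theorem isExposed_segment_latticeHull {n : ℕ} {S : Set (Fin n → ℤ)} {l : (Fin n → ℝ) →L[ℝ] ℝ}
    {a b : Fin n → ℤ} (ha : a ∈ S) (hb : b ∈ S)
    (hS : ∀ s ∈ S, l (toR s) ≤ l (toR a)) (hl : l (toR b) = l (toR a))
    (hseg : ∀ s ∈ S, l (toR s) = l (toR a) → toR s ∈ segment ℝ (toR a) (toR b)) :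
    IsExposed ℝ (latticeHull S) (segment ℝ (toR a) (toR b)) := by
  have h : ∀ t ∈ toR '' S, l t ≤ l (toR a) := by
    rintro _ ⟨s, hs, rfl⟩
    exact hS s hs
  suffices hface : segment ℝ (toR a) (toR b) = convexHull ℝ {t ∈ toR '' S | l t = l (toR a)} by
    rw [hface]
    exact isExposed_convexHull_sep h
  apply Set.Subset.antisymm
  · rw [← convexHull_pair]
    refine convexHull_mono ?_
    rintro _ (rfl | rfl)
    · exact ⟨⟨a, ha, rfl⟩, rfl⟩
    · exact ⟨⟨b, hb, rfl⟩, hl⟩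
  · refine convexHull_min ?_ (convex_segment _ _)
    rintro _ ⟨⟨s, hs, rfl⟩, hs'⟩
    exact hseg s hs hs'

/-- The functional `l` attains its maximum over `S` exactly at `v`. -/
def IsStrictMaxAt {n : ℕ} (S : Set (Fin n → ℤ)) (l : (Fin n → ℝ) →L[ℝ] ℝ) (v : Fin n → ℤ) : Prop :=
  v ∈ S ∧ ∀ s ∈ S, s ≠ v → l (toR s) < l (toR v)

theorem IsStrictMaxAt.le {n : ℕ} {S : Set (Fin n → ℤ)} {l : (Fin n → ℝ) →L[ℝ] ℝ} {v : Fin n → ℤ}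
    (h : IsStrictMaxAt S l v) {s : Fin n → ℤ} (hs : s ∈ S) : l (toR s) ≤ l (toR v) := by
  by_cases hsv : s = v
  · rw [hsv]
  · exact (h.2 s hs hsv).le

theorem IsStrictMaxAt.isVertex {n : ℕ} {S : Set (Fin n → ℤ)} {l : (Fin n → ℝ) →L[ℝ] ℝ}
    {v : Fin n → ℤ} (h : IsStrictMaxAt S l v) : IsVertex (latticeHull S) (toR v) := by
  have := isExposed_segment_latticeHull h.1 h.1 (fun s hs => h.le hs) rfl (fun s hs hsv => by
    by_cases hs' : s = v
    · rw [hs']; exact left_mem_segment ℝ _ _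
    · exact absurd hsv (h.2 s hs hs').ne)
  rw [segment_same] at this
  exact isExtreme_singleton.1 this.isExtreme

theorem exists_isStrictMaxAt_of_mem_extremePoints {n : ℕ} {S : Set (Fin n → ℤ)} (hS : S.Finite)
    {x : Fin n → ℝ} (hx : x ∈ Set.extremePoints ℝ (latticeHull S)) :
    ∃ v l, toR v = x ∧ IsStrictMaxAt S l v := by
  obtain ⟨v, hv, rfl⟩ := extremePoints_convexHull_subset hx
  have hfin : (toR '' (S \ {v})).Finite := (hS.subset Set.sdiff_subset).image _
  have hnot : toR v ∉ convexHull ℝ (toR '' (S \ {v})) := by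
    intro hmem
    have hc := ((convex_convexHull ℝ _).mem_extremePoints_iff_convex_sdiff.1 hx).2
    refine (convexHull_min ?_ hc hmem).2 rfl
    rintro _ ⟨s, hs, rfl⟩
    exact ⟨subset_convexHull ℝ _ ⟨s, hs.1, rfl⟩, fun h => hs.2 (toR_injective h)⟩
  obtain ⟨f, u, hfu, hf⟩ := geometric_hahn_banach_point_closed (convex_convexHull ℝ _)
    (hfin.isClosed_convexHull (𝕜 := ℝ)) hnot
  refine ⟨v, -f, rfl, hv, fun s hs hsv => ?_⟩
  have := hf _ (subset_convexHull ℝ _ ⟨s, ⟨hs, hsv⟩, rfl⟩)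
  simp only [neg_apply]
  linarith

theorem eventually_isStrictMaxAt {n : ℕ} {S : Set (Fin n → ℤ)} (hS : S.Finite)
    {l g : (Fin n → ℝ) →L[ℝ] ℝ} {v : Fin n → ℤ} (hv : v ∈ S)
    (h : ∀ s ∈ S, s ≠ v → l (toR s) < l (toR v) ∨
      (l (toR s) = l (toR v) ∧ g (toR s) < g (toR v))) :
    ∀ᶠ ε in nhdsWithin (0 : ℝ) (Set.Ioi 0), IsStrictMaxAt S (l + ε • g) v := by
  have key : ∀ s ∈ S, ∀ᶠ ε in nhdsWithin (0 : ℝ) (Set.Ioi 0),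
      s ≠ v → (l + ε • g) (toR s) < (l + ε • g) (toR v) := by
    intro s hs
    by_cases hsv : s = v
    · simp [hsv]
    simp only [add_apply, smul_apply, smul_eq_mul]
    rcases h s hs hsv with h' | ⟨h1, h2⟩
    · have hc : ∀ x, Filter.Tendsto (fun ε : ℝ => l x + ε * g x)
          (nhdsWithin (0 : ℝ) (Set.Ioi 0)) (nhds (l x)) := fun x => by
        have : Continuous (fun ε : ℝ => l x + ε * g x) := by fun_prop
        simpa using (this.tendsto 0).mono_left nhdsWithin_le_nhds
      filter_upwards [(hc (toR s)).eventually_lt (hc (toR v)) h'] with ε hε _ using hε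
    · filter_upwards [self_mem_nhdsWithin] with ε hε _
      have := mul_lt_mul_of_pos_left h2 (show 0 < ε from hε)
      linarith
  filter_upwards [(Filter.eventually_all_finite hS).2 key] with ε hε using ⟨hv, hε⟩

theorem exists_lex_max {n : ℕ} {S : Set (Fin n → ℤ)} (hS : S.Finite) (hne : S.Nonempty)
    (l : (Fin n → ℝ) →L[ℝ] ℝ) {g : (Fin n → ℝ) →L[ℝ] ℝ}
    (hg : Function.Injective fun s : Fin n → ℤ => g (toR s)) :
    ∃ v ∈ S, ∀ s ∈ S, s ≠ v → l (toR s) < l (toR v) ∨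
      (l (toR s) = l (toR v) ∧ g (toR s) < g (toR v)) := by
  obtain ⟨v, hv, hmax⟩ := Set.exists_max_image S
    (fun s => toLex (l (toR s), g (toR s))) hS hne
  refine ⟨v, hv, fun s hs hsv => ?_⟩
  rcases (Prod.Lex.toLex_le_toLex.1 (hmax s hs)) with h | ⟨h, h'⟩
  · exact Or.inl h
  · exact Or.inr ⟨h, lt_of_le_of_ne h' fun h => hsv (hg h)⟩

/-- The functional `x ↦ p x₀ + q x₁` on the plane. -/
noncomputable def planeForm (p q : ℝ) : (Fin 2 → ℝ) →L[ℝ] ℝ :=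
  p • ContinuousLinearMap.proj 0 + q • ContinuousLinearMap.proj 1

@[simp]
theorem planeForm_apply (p q : ℝ) (x : Fin 2 → ℝ) : planeForm p q x = p * x 0 + q * x 1 := by
  simp [planeForm]

theorem exists_eq_planeForm (l : (Fin 2 → ℝ) →L[ℝ] ℝ) : ∃ p q, l = planeForm p q := by
  refine ⟨l (Pi.single 0 1), l (Pi.single 1 1), ContinuousLinearMap.ext fun x => ?_⟩
  have hx : x = x 0 • Pi.single 0 1 + x 1 • Pi.single 1 1 := by
    ext i
    fin_cases i <;> simp
  conv_lhs => rw [hx]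
  simp only [map_add, map_smul, smul_eq_mul, planeForm_apply]
  ring

theorem planeForm_sqrt_two_injective :
    Function.Injective fun s : Fin 2 → ℤ => planeForm 1 (√2) (toR s) := by
  intro s t hst
  simp only [planeForm_apply, toR, one_mul] at hst
  have h1 : s 1 = t 1 := by
    by_contra hne
    have hne' : (s 1 : ℝ) - t 1 ≠ 0 := sub_ne_zero.2 (by exact_mod_cast hne)
    refine irrational_sqrt_two ⟨((t 0 - s 0 : ℤ) : ℚ) / ((s 1 - t 1 : ℤ) : ℚ), ?_⟩
    push_cast
    rw [div_eq_iff hne']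
    linarith
  have h0 : s 0 = t 0 := by
    rw [h1] at hst
    exact_mod_cast add_right_cancel hst
  ext i
  fin_cases i
  · exact h0
  · exact h1

theorem mem_segment_of_apply_eq {l g : (Fin 2 → ℝ) →L[ℝ] ℝ} (hl : l ≠ 0) {c d s : Fin 2 → ℝ}
    (hd : l d = l c) (hs : l s = l c) (h1 : g d ≤ g s) (h2 : g s ≤ g c) (h3 : g d < g c) :
    s ∈ segment ℝ c d := by
  obtain ⟨p, q, rfl⟩ := exists_eq_planeForm l
  obtain ⟨p', q', rfl⟩ := exists_eq_planeForm g
  simp only [planeForm_apply] at *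
  have hpq : p ≠ 0 ∨ q ≠ 0 := by
    by_contra! h
    exact hl (by ext; simp [h.1, h.2])
  have hcross : (s 0 - c 0) * (d 1 - c 1) = (s 1 - c 1) * (d 0 - c 0) := by
    rcases hpq with h | h
    · apply mul_left_cancel₀ h
      linear_combination (d 1 - c 1) * hs - (s 1 - c 1) * hd
    · apply mul_left_cancel₀ h
      linear_combination - (d 0 - c 0) * hs + (s 0 - c 0) * hd
  have hpos : 0 < (p' * c 0 + q' * c 1) - (p' * d 0 + q' * d 1) := by linarith
  set D := (p' * c 0 + q' * c 1) - (p' * d 0 + q' * d 1) with hD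
  set μ := ((p' * c 0 + q' * c 1) - (p' * s 0 + q' * s 1)) / D with hμ
  have hμD : μ * D = (p' * c 0 + q' * c 1) - (p' * s 0 + q' * s 1) :=
    div_mul_cancel₀ _ hpos.ne'
  have hμ0 : 0 ≤ μ := div_nonneg (by linarith) hpos.le
  have hμ1 : μ ≤ 1 := (div_le_one hpos).2 (by linarith)
  refine ⟨1 - μ, μ, by linarith, hμ0, by ring, ?_⟩
  ext i
  apply mul_right_cancel₀ hpos.ne'
  fin_cases i
  · simp only [Fin.zero_eta, Pi.add_apply, Pi.smul_apply, smul_eq_mul]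
    have : ((1 - μ) * c 0 + μ * d 0) * D = c 0 * D + (μ * D) * (d 0 - c 0) := by ring
    rw [this, hμD, hD]
    linear_combination q' * hcross
  · simp only [Fin.mk_one, Pi.add_apply, Pi.smul_apply, smul_eq_mul]
    have : ((1 - μ) * c 1 + μ * d 1) * D = c 1 * D + (μ * D) * (d 1 - c 1) := by ring
    rw [this, hμD, hD]
    linear_combination -p' * hcross

theorem exists_apply_ne_of_isFullDim {n : ℕ} {S : Set (Fin n → ℤ)}
    (hS : IsFullDim (latticeHull S)) {f : (Fin n → ℝ) →L[ℝ] ℝ} (hf : f ≠ 0) (w : Fin n → ℤ) :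
    ∃ s ∈ S, f (toR s) ≠ f (toR w) := by
  by_contra! h
  apply hf
  rw [IsFullDim, latticeHull, affineSpan_convexHull] at hS
  have hle : affineSpan ℝ (toR '' S) ≤ AffineSubspace.mk' (toR w) f.ker := by
    rw [affineSpan_le]
    rintro _ ⟨s, hs, rfl⟩
    simp [AffineSubspace.mem_mk', h s hs]
  rw [hS] at hle
  ext x
  have : x + toR w ∈ AffineSubspace.mk' (toR w) f.ker := hle (AffineSubspace.mem_top ℝ _ _)
  simpa [AffineSubspace.mem_mk'] using this

/-- A vertex of a plane polygon admits an edge on the side selected by the functional `u`. -/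
theorem exists_edge_of_isStrictMaxAt {S : Set (Fin 2 → ℤ)} (hS : S.Finite) {w : Fin 2 → ℤ}
    {l u : (Fin 2 → ℝ) →L[ℝ] ℝ} (hw : IsStrictMaxAt S l w) (hne : ∃ s ∈ S, s ≠ w)
    (hu : ∀ m : ℝ, u + m • l ≠ 0) :
    ∃ d ∈ S, d ≠ w ∧ ∃ m : ℝ, (∀ s ∈ S, (u + m • l) (toR s) ≤ (u + m • l) (toR w)) ∧
      (u + m • l) (toR d) = (u + m • l) (toR w) ∧
      ∀ s ∈ S, (u + m • l) (toR s) = (u + m • l) (toR w) →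
        toR s ∈ segment ℝ (toR w) (toR d) := by
  obtain ⟨s₀, hs₀, hs₀w⟩ := hne
  obtain ⟨t, ⟨ht, htw⟩, htmax⟩ := Set.exists_max_image (S \ {w})
    (fun s => (u (toR s) - u (toR w)) / (l (toR w) - l (toR s)))
    (hS.subset Set.sdiff_subset) ⟨s₀, hs₀, hs₀w⟩
  set m := (u (toR t) - u (toR w)) / (l (toR w) - l (toR t)) with hm
  have hle : ∀ s ∈ S, (u + m • l) (toR s) ≤ (u + m • l) (toR w) := by
    intro s hs
    by_cases hsw : s = w
    · rw [hsw]
    have h := htmax s ⟨hs, hsw⟩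
    simp only [add_apply, smul_apply, smul_eq_mul]
    rw [div_le_iff₀ (sub_pos.2 (hw.2 s hs hsw))] at h
    linarith
  have hteq : (u + m • l) (toR t) = (u + m • l) (toR w) := by
    have := div_mul_cancel₀ (u (toR t) - u (toR w)) (sub_pos.2 (hw.2 t ht htw)).ne'
    rw [← hm] at this
    simp only [add_apply, smul_apply, smul_eq_mul]
    linarith
  obtain ⟨d, ⟨hd, hdeq⟩, hdmin⟩ := Set.exists_min_image
    {s ∈ S | (u + m • l) (toR s) = (u + m • l) (toR w)} (fun s => l (toR s))
    (hS.subset fun s hs => hs.1) ⟨t, ht, hteq⟩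
  have hdw : l (toR d) < l (toR w) := (hdmin t ⟨ht, hteq⟩).trans_lt (hw.2 t ht htw)
  refine ⟨d, hd, fun h => hdw.ne (by rw [h]), m, hle, hdeq, fun s hs hseq => ?_⟩
  exact mem_segment_of_apply_eq (hu m) hdeq hseq (hdmin s ⟨hs, hseq⟩) (hw.le hs) hdw

/-- A vertex of a plane polygon lies on two distinct edges. -/
theorem exists_two_edges_of_isStrictMaxAt {S : Set (Fin 2 → ℤ)} (hS : S.Finite)
    (hfull : IsFullDim (latticeHull S)) {w : Fin 2 → ℤ} {l : (Fin 2 → ℝ) →L[ℝ] ℝ}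
    (hw : IsStrictMaxAt S l w) :
    ∃ d₁ ∈ S, ∃ d₂ ∈ S, d₁ ≠ d₂ ∧ ∀ d, d = d₁ ∨ d = d₂ → d ≠ w ∧
      ∃ f : (Fin 2 → ℝ) →L[ℝ] ℝ, (∀ s ∈ S, f (toR s) ≤ f (toR w)) ∧ f (toR d) = f (toR w) ∧
        ∀ s ∈ S, f (toR s) = f (toR w) → toR s ∈ segment ℝ (toR w) (toR d) := by
  have hne : ∃ s ∈ S, s ≠ w := by
    have hf : planeForm 1 0 ≠ 0 := fun h => by
      simpa using congrArg (fun f : (Fin 2 → ℝ) →L[ℝ] ℝ => f (Pi.single 0 1)) h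
    obtain ⟨s, hs, hsw⟩ := exists_apply_ne_of_isFullDim hfull hf w
    exact ⟨s, hs, fun h => hsw (by rw [h])⟩
  obtain ⟨p, q, rfl⟩ := exists_eq_planeForm l
  have hpq : 0 < p ^ 2 + q ^ 2 := by
    by_contra! h
    obtain rfl : p = 0 := by nlinarith [sq_nonneg p, sq_nonneg q]
    obtain rfl : q = 0 := by nlinarith [sq_nonneg q]
    obtain ⟨s, hs, hsw⟩ := hne
    simpa using hw.2 s hs hsw
  have hu : ∀ m : ℝ, planeForm (-q) p + m • planeForm p q ≠ 0 := fun m h => by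
    have := congrArg (fun f : (Fin 2 → ℝ) →L[ℝ] ℝ => f ![-q, p]) h
    simp at this
    nlinarith
  have hu' : ∀ m : ℝ, -planeForm (-q) p + m • planeForm p q ≠ 0 := fun m h => by
    apply hu (-m)
    rw [← neg_eq_zero, ← h]
    module
  obtain ⟨d₁, hd₁, hdw₁, m₁, hle₁, heq₁, hseg₁⟩ := exists_edge_of_isStrictMaxAt hS hw hne hu
  obtain ⟨d₂, hd₂, hdw₂, m₂, hle₂, heq₂, hseg₂⟩ := exists_edge_of_isStrictMaxAt hS hw hne hu'
  refine ⟨d₁, hd₁, d₂, hd₂, ?_, ?_⟩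
  · rintro rfl
    obtain ⟨s, hs, hsw⟩ := exists_apply_ne_of_isFullDim hfull (hu m₁) w
    have hlt := (hle₁ s hs).lt_of_ne hsw
    have hle := hle₂ s hs
    have hl := hw.2 d₁ hd₁ hdw₁
    generalize planeForm (-q) p = u at *
    generalize planeForm p q = l at *
    simp only [add_apply, smul_apply, neg_apply, smul_eq_mul] at *
    have hm : m₂ = -m₁ := by
      have : (m₁ + m₂) * (l (toR d₁) - l (toR w)) = 0 := by linarith
      rcases mul_eq_zero.1 this with h | h
      · linarith
      · linarith
    subst hm
    linarith
  · rintro d (rfl | rfl)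
    · exact ⟨hdw₁, _, hle₁, heq₁, hseg₁⟩
    · exact ⟨hdw₂, _, hle₂, heq₂, hseg₂⟩

theorem SmoothAtVertex.card_le {n : ℕ} {P : Set (Fin n → ℝ)} {v : Fin n → ℤ}
    (h : SmoothAtVertex P v) (E : Finset (Fin n → ℤ)) (hE : ∀ c ∈ E, IsEdge P v c) :
    E.card ≤ n := by
  obtain ⟨b, -, -, hb, -⟩ := h
  choose i hi using fun c : E => hb c (hE c c.2)
  have hinj : Function.Injective i := by
    rintro c d hcd
    have hseg := (hi c).trans ((congrArg (fun j => segment ℝ (toR v) (toR (b j))) hcd).trans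
      (hi d).symm)
    have h1 : toR c.1 ∈ segment ℝ (toR v) (toR d.1) := hseg ▸ right_mem_segment ℝ _ _
    have h2 : toR d.1 ∈ segment ℝ (toR v) (toR c.1) := hseg ▸ right_mem_segment ℝ _ _
    rw [mem_segment_iff_wbtw] at h1 h2
    exact Subtype.ext (toR_injective ((wbtw_swap_right_iff ℝ (toR v)).1 ⟨h1, h2⟩))
  simpa using Fintype.card_le_of_injective i hinj

/-- The lattice point `(v, c)`. -/
def atHeight {n : ℕ} (c : ℤ) (v : Fin n → ℤ) : Fin (n + 1) → ℤ := Fin.snoc v c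

theorem atHeight_injective {n : ℕ} (c : ℤ) : Function.Injective (atHeight (n := n) c) :=
  fun v w h => funext fun i => by simpa [atHeight] using congrFun h i.castSucc

theorem atHeight_ne {n : ℕ} {c d : ℤ} (h : c ≠ d) (v w : Fin n → ℤ) :
    atHeight c v ≠ atHeight d w := fun he =>
  h (by simpa [atHeight] using congrFun he (Fin.last n))

theorem toR_atHeight (c : ℤ) (v : Fin 2 → ℤ) : toR (atHeight c v) = emb c (toR v) := by
  ext i
  refine Fin.lastCases ?_ (fun j => ?_) i <;> simp [toR, atHeight, emb, Fin.snoc]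

/-- The affine map underlying `emb c`. -/
noncomputable def embAffine (c : ℝ) : (Fin 2 → ℝ) →ᵃ[ℝ] (Fin 3 → ℝ) where
  toFun := emb c
  linear := LinearMap.pi (Fin.snoc (fun i : Fin 2 => LinearMap.proj i) 0)
  map_vadd' p v := by
    ext i
    refine Fin.lastCases ?_ (fun j => ?_) i
    · simp [emb, Fin.snoc]
    · simp [emb]

theorem emb_mem_segment {c : ℝ} {x y z : Fin 2 → ℝ} (h : x ∈ segment ℝ y z) :
    emb c x ∈ segment ℝ (emb c y) (emb c z) :=
  (image_segment ℝ (embAffine c) y z).subset ⟨x, h, rfl⟩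

/-- The functional `(x, z) ↦ l x + t z` on space. -/
noncomputable def liftForm (l : (Fin 2 → ℝ) →L[ℝ] ℝ) (t : ℝ) : (Fin 3 → ℝ) →L[ℝ] ℝ :=
  l.comp (ContinuousLinearMap.pi fun i : Fin 2 => ContinuousLinearMap.proj i.castSucc) +
    t • ContinuousLinearMap.proj (Fin.last 2)

@[simp]
theorem liftForm_emb (l : (Fin 2 → ℝ) →L[ℝ] ℝ) (t c : ℝ) (x : Fin 2 → ℝ) :
    liftForm l t (emb c x) = l x + t * c := by
  have h : (ContinuousLinearMap.pi fun i : Fin 2 =>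
      (ContinuousLinearMap.proj i.castSucc : (Fin 3 → ℝ) →L[ℝ] ℝ)) (emb c x) = x := by
    ext i
    simp [emb]
  rw [liftForm, add_apply, ContinuousLinearMap.comp_apply, h]
  simp [emb, Fin.snoc]

/-- The Cayley polytope with the hulls of `S₀` and `S₁` placed at heights `α` and `β`. -/
def cayley (α β : ℤ) (S₀ S₁ : Set (Fin 2 → ℤ)) : Set (Fin 3 → ℝ) :=
  latticeHull (atHeight α '' S₀ ∪ atHeight β '' S₁)

theorem cayley_comm (α β : ℤ) (S₀ S₁ : Set (Fin 2 → ℤ)) :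
    cayley α β S₀ S₁ = cayley β α S₁ S₀ := by
  rw [cayley, cayley, Set.union_comm]

theorem convexHull_emb_eq_cayley (α β : ℤ) (S₀ S₁ : Set (Fin 2 → ℤ)) :
    convexHull ℝ (emb α '' latticeHull S₀ ∪ emb β '' latticeHull S₁) = cayley α β S₀ S₁ := by
  have h : ∀ (c : ℤ) S, emb c '' latticeHull S = convexHull ℝ (toR '' (atHeight c '' S)) := by
    intro c S
    have h1 := (embAffine c).image_convexHull (toR '' S)
    rw [latticeHull]
    refine h1.trans ?_
    rw [Set.image_image, Set.image_image]
    simp only [toR_atHeight]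
    rfl
  rw [h, h, convexHull_convexHull_union_left, convexHull_convexHull_union_right, cayley,
    latticeHull, Set.image_union]

theorem isEdge_cayley_of_isStrictMaxAt {α β : ℤ} (hαβ : α ≠ β) {S₀ S₁ : Set (Fin 2 → ℤ)}
    {l : (Fin 2 → ℝ) →L[ℝ] ℝ} {v w : Fin 2 → ℤ} (hv : IsStrictMaxAt S₀ l v)
    (hw : IsStrictMaxAt S₁ l w) :
    IsEdge (cayley α β S₀ S₁) (atHeight β w) (atHeight α v) := by
  have hne : (α : ℝ) - β ≠ 0 := sub_ne_zero.2 (by exact_mod_cast hαβ)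
  obtain ⟨t, ht⟩ : ∃ t : ℝ, l (toR v) + t * α = l (toR w) + t * β :=
    ⟨(l (toR w) - l (toR v)) / (α - β), by
      have := div_mul_cancel₀ (l (toR w) - l (toR v)) hne
      linarith⟩
  refine ⟨atHeight_ne hαβ.symm _ _, isExposed_segment_latticeHull (l := liftForm l t)
    (Or.inr ⟨w, hw.1, rfl⟩) (Or.inl ⟨v, hv.1, rfl⟩) ?_ ?_ ?_⟩
  · rintro _ (⟨s, hs, rfl⟩ | ⟨s, hs, rfl⟩)
    · have := hv.le hs
      simp only [toR_atHeight, liftForm_emb]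
      linarith
    · have := hw.le hs
      simp only [toR_atHeight, liftForm_emb]
      linarith
  · simpa only [toR_atHeight, liftForm_emb] using ht
  · rintro _ (⟨s, hs, rfl⟩ | ⟨s, hs, rfl⟩) h
    · by_cases hsv : s = v
      · rw [hsv]
        exact right_mem_segment ℝ _ _
      · have := hv.2 s hs hsv
        simp only [toR_atHeight, liftForm_emb] at h
        linarith
    · by_cases hsw : s = w
      · rw [hsw]
        exact left_mem_segment ℝ _ _
      · have := hw.2 s hs hsw
        simp only [toR_atHeight, liftForm_emb] at h
        linarith

theorem exists_height_coeff {α β : ℝ} (hαβ : α ≠ β) {S : Set (Fin 2 → ℤ)} (hS : S.Finite)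
    (f : (Fin 2 → ℝ) →L[ℝ] ℝ) (M : ℝ) : ∃ t : ℝ, ∀ s ∈ S, f (toR s) + t * α < M + t * β := by
  obtain ⟨C, hC⟩ := (hS.image fun s => f (toR s)).bddAbove
  refine ⟨(C + 1 - M) / (β - α), fun s hs => ?_⟩
  have := div_mul_cancel₀ (C + 1 - M) (sub_ne_zero.2 hαβ.symm)
  have := hC ⟨s, hs, rfl⟩
  dsimp only at this
  linarith

theorem isVertex_cayley {α β : ℤ} (hαβ : α ≠ β) {S₀ S₁ : Set (Fin 2 → ℤ)}
    (hS₀ : S₀.Finite) {l : (Fin 2 → ℝ) →L[ℝ] ℝ} {w : Fin 2 → ℤ} (hw : IsStrictMaxAt S₁ l w) :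
    IsVertex (cayley α β S₀ S₁) (toR (atHeight β w)) := by
  obtain ⟨t, ht⟩ := exists_height_coeff (Int.cast_injective.ne hαβ) hS₀ l (l (toR w))
  refine IsStrictMaxAt.isVertex (l := liftForm l t) ⟨Or.inr ⟨w, hw.1, rfl⟩, ?_⟩
  rintro _ (⟨s, hs, rfl⟩ | ⟨s, hs, rfl⟩) hne
  · simpa only [toR_atHeight, liftForm_emb] using ht s hs
  · simpa only [toR_atHeight, liftForm_emb, add_lt_add_iff_right] using
      hw.2 s hs fun h => hne (by rw [h])

theorem isEdge_cayley_of_edge {α β : ℤ} (hαβ : α ≠ β) {S₀ S₁ : Set (Fin 2 → ℤ)}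
    (hS₀ : S₀.Finite) {f : (Fin 2 → ℝ) →L[ℝ] ℝ} {w d : Fin 2 → ℤ} (hw : w ∈ S₁) (hd : d ∈ S₁)
    (hdw : d ≠ w) (hle : ∀ s ∈ S₁, f (toR s) ≤ f (toR w)) (heq : f (toR d) = f (toR w))
    (hseg : ∀ s ∈ S₁, f (toR s) = f (toR w) → toR s ∈ segment ℝ (toR w) (toR d)) :
    IsEdge (cayley α β S₀ S₁) (atHeight β w) (atHeight β d) := by
  obtain ⟨t, ht⟩ := exists_height_coeff (Int.cast_injective.ne hαβ) hS₀ f (f (toR w))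
  refine ⟨fun h => hdw (atHeight_injective β h).symm, isExposed_segment_latticeHull
    (l := liftForm f t) (Or.inr ⟨w, hw, rfl⟩) (Or.inr ⟨d, hd, rfl⟩) ?_ ?_ ?_⟩
  · rintro _ (⟨s, hs, rfl⟩ | ⟨s, hs, rfl⟩)
    · simpa only [toR_atHeight, liftForm_emb] using (ht s hs).le
    · simpa only [toR_atHeight, liftForm_emb, add_le_add_iff_right] using hle s hs
  · simpa only [toR_atHeight, liftForm_emb, add_left_inj] using heq
  · rintro _ (⟨s, hs, rfl⟩ | ⟨s, hs, rfl⟩) h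
    · simp only [toR_atHeight, liftForm_emb] at h
      exact absurd h (ht s hs).ne
    · simp only [toR_atHeight, liftForm_emb, add_left_inj] at h ⊢
      exact emb_mem_segment (hseg s hs h)

/-- In a smooth Cayley polytope, a vertex on one side is joined to at most one vertex on the
other side. -/
theorem eq_of_isStrictMaxAt {α β : ℤ} (hαβ : α ≠ β) {S₀ S₁ : Set (Fin 2 → ℤ)}
    (hS₀ : S₀.Finite) (hS₁ : S₁.Finite) (hfull : IsFullDim (latticeHull S₁))
    (hP : IsSmoothPolytope (cayley α β S₀ S₁)) {l l' : (Fin 2 → ℝ) →L[ℝ] ℝ}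
    {v v' w : Fin 2 → ℤ} (hv : IsStrictMaxAt S₀ l v) (hw : IsStrictMaxAt S₁ l w)
    (hv' : IsStrictMaxAt S₀ l' v') (hw' : IsStrictMaxAt S₁ l' w) : v = v' := by
  by_contra hne
  have h1 := isEdge_cayley_of_isStrictMaxAt hαβ hv hw
  have h2 := isEdge_cayley_of_isStrictMaxAt hαβ hv' hw'
  obtain ⟨d₁, hd₁, d₂, hd₂, hd, hdedge⟩ := exists_two_edges_of_isStrictMaxAt hS₁ hfull hw
  have h3 : ∀ d, d = d₁ ∨ d = d₂ →
      IsEdge (cayley α β S₀ S₁) (atHeight β w) (atHeight β d) := by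
    intro d hd'
    obtain ⟨hdw, f, hle, heq, hseg⟩ := hdedge d hd'
    refine isEdge_cayley_of_edge hαβ hS₀ hw.1 ?_ hdw hle heq hseg
    rcases hd' with rfl | rfl <;> assumption
  have hcard := (hP.2.2 _ (isVertex_cayley hαβ hS₀ hw)).card_le
    {atHeight α v, atHeight α v', atHeight β d₁, atHeight β d₂} (by
      simp only [Finset.mem_insert, Finset.mem_singleton]
      rintro _ (rfl | rfl | rfl | rfl)
      · exact h1
      · exact h2
      · exact h3 _ (Or.inl rfl)
      · exact h3 _ (Or.inr rfl))
  rw [Finset.card_insert_of_notMem, Finset.card_insert_of_notMem,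
    Finset.card_insert_of_notMem, Finset.card_singleton] at hcard
  · omega
  · simpa using (atHeight_injective β).ne hd
  · simp [atHeight_ne hαβ]
  · simp [atHeight_ne hαβ, (atHeight_injective α).ne hne]

theorem exists_common_isStrictMaxAt {S₀ S₁ : Set (Fin 2 → ℤ)} (hS₀ : S₀.Finite) (hS₁ : S₁.Finite)
    {l g : (Fin 2 → ℝ) →L[ℝ] ℝ} {v w : Fin 2 → ℤ} (hv : v ∈ S₀) (hw : w ∈ S₁)
    (h₀ : ∀ s ∈ S₀, s ≠ v → l (toR s) < l (toR v) ∨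
      (l (toR s) = l (toR v) ∧ g (toR s) < g (toR v)))
    (h₁ : ∀ s ∈ S₁, s ≠ w → l (toR s) < l (toR w) ∨
      (l (toR s) = l (toR w) ∧ g (toR s) < g (toR w))) :
    ∃ l', IsStrictMaxAt S₀ l' v ∧ IsStrictMaxAt S₁ l' w := by
  obtain ⟨ε, hε⟩ := ((eventually_isStrictMaxAt hS₀ hv h₀).and
    (eventually_isStrictMaxAt hS₁ hw h₁)).exists
  exact ⟨_, hε⟩

theorem ncard_extremePoints_le {α β : ℤ} (hαβ : α ≠ β) {S₀ S₁ : Set (Fin 2 → ℤ)}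
    (hS₀ : S₀.Finite) (hS₁ : S₁.Finite) (hne : S₁.Nonempty) (hfull : IsFullDim (latticeHull S₁))
    (hP : IsSmoothPolytope (cayley α β S₀ S₁)) :
    (Set.extremePoints ℝ (latticeHull S₀)).ncard ≤
      (Set.extremePoints ℝ (latticeHull S₁)).ncard := by
  have key : ∀ x ∈ Set.extremePoints ℝ (latticeHull S₀), ∃ w v l, toR v = x ∧
      IsStrictMaxAt S₀ l v ∧ IsStrictMaxAt S₁ l w := by
    intro x hx
    obtain ⟨v, l, hvx, hv⟩ := exists_isStrictMaxAt_of_mem_extremePoints hS₀ hx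
    obtain ⟨w, hw, hw'⟩ := exists_lex_max hS₁ hne l planeForm_sqrt_two_injective
    obtain ⟨l', h⟩ := exists_common_isStrictMaxAt hS₀ hS₁ hv.1 hw
      (fun s hs hsv => Or.inl (hv.2 s hs hsv)) hw'
    exact ⟨w, v, l', hvx, h⟩
  choose! f v l hvx hv hf using key
  refine Set.ncard_le_ncard_of_injOn (fun x => toR (f x)) (fun x hx => (hf x hx).isVertex) ?_
    ((hS₁.image toR).subset extremePoints_convexHull_subset)
  intro x hx y hy hxy
  have hxy' : f x = f y := toR_injective hxy
  rw [← hvx x hx, ← hvx y hy]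
  exact congrArg toR
    (eq_of_isStrictMaxAt hαβ hS₀ hS₁ hfull hP (hv x hx) (hf x hx) (hv y hy) (hxy' ▸ hf y hy))

theorem exists_parallel_edge {α β : ℤ} (hαβ : α ≠ β) {S₀ S₁ : Set (Fin 2 → ℤ)}
    (hS₀ : S₀.Finite) (hS₁ : S₁.Finite) (hne : S₁.Nonempty) (hfull : IsFullDim (latticeHull S₁))
    (hP : IsSmoothPolytope (cayley α β S₀ S₁)) {l : (Fin 2 → ℝ) →L[ℝ] ℝ} (hl : l ≠ 0) {M : ℝ}
    (hM : ∀ s ∈ S₀, l (toR s) ≤ M) (hface : {s ∈ S₀ | l (toR s) = M}.Nontrivial) :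
    ∃ c ∈ S₁, ∃ d ∈ S₁, c ≠ d ∧ (∀ s ∈ S₁, l (toR s) ≤ l (toR c)) ∧ l (toR d) = l (toR c) ∧
      ∀ s ∈ S₁, l (toR s) = l (toR c) → toR s ∈ segment ℝ (toR c) (toR d) := by
  have hg := planeForm_sqrt_two_injective
  have hg' : Function.Injective fun s : Fin 2 → ℤ => (-planeForm 1 (√2)) (toR s) :=
    fun s t h => hg (neg_injective h)
  generalize planeForm 1 (√2) = g at hg hg'
  obtain ⟨v, hv, hv'⟩ := hface.nonempty
  obtain ⟨v₁, hv₁, hmax₁⟩ := exists_lex_max hS₀ ⟨v, hv⟩ l hg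
  obtain ⟨v₂, hv₂, hmax₂⟩ := exists_lex_max hS₀ ⟨v, hv⟩ l hg'
  obtain ⟨c, hc, hmaxc⟩ := exists_lex_max hS₁ hne l hg
  obtain ⟨d, hd, hmaxd⟩ := exists_lex_max hS₁ hne l hg'
  have hvne : v₁ ≠ v₂ := by
    rintro rfl
    obtain ⟨s, ⟨hs, hsM⟩, hsv⟩ := hface.exists_ne v₁
    have hle := hM v₁ hv₁
    rcases hmax₁ s hs hsv with h | ⟨-, h⟩
    · linarith
    rcases hmax₂ s hs hsv with h' | ⟨-, h'⟩
    · linarith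
    simp only [neg_apply] at h'
    linarith
  have hcd : c ≠ d := by
    rintro rfl
    obtain ⟨l₁, h₁, h₁'⟩ := exists_common_isStrictMaxAt hS₀ hS₁ hv₁ hc hmax₁ hmaxc
    obtain ⟨l₂, h₂, h₂'⟩ := exists_common_isStrictMaxAt hS₀ hS₁ hv₂ hc hmax₂ hmaxd
    exact hvne (eq_of_isStrictMaxAt hαβ hS₀ hS₁ hfull hP h₁ h₁' h₂ h₂')
  have hlec : ∀ s ∈ S₁, l (toR s) ≤ l (toR c) := fun s hs => by
    by_cases hsc : s = c
    · rw [hsc]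
    · rcases hmaxc s hs hsc with h | h
      exacts [h.le, h.1.le]
  have hldc : l (toR d) = l (toR c) := by
    refine le_antisymm (hlec d hd) ?_
    rcases hmaxd c hc hcd with h | h
    exacts [h.le, h.1.le]
  have hgc : ∀ s ∈ S₁, l (toR s) = l (toR c) → s ≠ c → g (toR s) < g (toR c) := by
    intro s hs hsl hsc
    rcases hmaxc s hs hsc with h | h
    exacts [absurd hsl h.ne, h.2]
  refine ⟨c, hc, d, hd, hcd, hlec, hldc, fun s hs hsl => ?_⟩
  refine mem_segment_of_apply_eq (g := g) hl hldc hsl ?_ ?_ (hgc d hd hldc hcd.symm)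
  · by_cases hsd : s = d
    · rw [hsd]
    rcases hmaxd s hs hsd with h | h
    · linarith
    · have := h.2
      simp only [neg_apply] at this
      linarith
  · by_cases hsc : s = c
    · rw [hsc]
    · exact (hgc s hs hsl hsc).le

theorem isFacet_latticeHull {S : Set (Fin 3 → ℤ)} {L : (Fin 3 → ℝ) →L[ℝ] ℝ} (hL : L ≠ 0) {M : ℝ}
    (hM : ∀ s ∈ S, L (toR s) ≤ M) {x y z : Fin 3 → ℝ}
    (hx : x ∈ {x ∈ latticeHull S | L x = M}) (hy : y ∈ {x ∈ latticeHull S | L x = M})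
    (hz : z ∈ {x ∈ latticeHull S | L x = M}) (hlin : LinearIndependent ℝ ![y - x, z - x]) :
    IsFacet (latticeHull S) {x ∈ latticeHull S | L x = M} := by
  have hM' : ∀ t ∈ toR '' S, L t ≤ M := by
    rintro _ ⟨s, hs, rfl⟩
    exact hM s hs
  constructor
  · rw [latticeHull, convexHull_sep_eq hM']
    exact isExposed_convexHull_sep hM'
  · rw [direction_affineSpan]
    apply le_antisymm
    · have htop : vectorSpan ℝ {x ∈ latticeHull S | L x = M} ≠ ⊤ := by
        intro htop
        have hle : vectorSpan ℝ {x ∈ latticeHull S | L x = M} ≤ L.ker := by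
          rw [vectorSpan_def, Submodule.span_le]
          rintro _ ⟨a, ha, b, hb, rfl⟩
          simp [ha.2, hb.2]
        rw [htop] at hle
        exact hL (ContinuousLinearMap.ext fun v => by simpa using hle (Submodule.mem_top (x := v)))
      have := Submodule.finrank_lt htop
      rw [Module.finrank_fin_fun] at this
      omega
    · have hspan := finrank_span_eq_card hlin
      rw [Fintype.card_fin] at hspan
      refine hspan.symm.le.trans ?_
      refine Submodule.finrank_mono (Submodule.span_le.2 ?_)
      rintro _ ⟨i, rfl⟩
      fin_cases i
      · exact vsub_mem_vectorSpan ℝ hy hx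
      · exact vsub_mem_vectorSpan ℝ hz hx

theorem exists_primitive_normal {l : (Fin 2 → ℝ) →L[ℝ] ℝ} (hl : l ≠ 0) {e : Fin 2 → ℤ}
    (he : e ≠ 0) (hle : l (toR e) = 0) :
    ∃ ν : Fin 2 → ℤ, ν ≠ 0 ∧ latticeLength ν = 1 ∧ ∃ μ : ℝ, 0 < μ ∧
      ∀ x, l x = μ * ∑ i, (ν i : ℝ) * x i := by
  obtain ⟨p, q, rfl⟩ := exists_eq_planeForm l
  have hgcd : 0 < Int.gcd (e 0) (e 1) := by
    rw [Int.gcd_pos_iff]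
    by_contra! h
    exact he (by ext i; fin_cases i; exacts [h.1, h.2])
  obtain ⟨m, n, hmn, hm, hn⟩ := Int.exists_gcd_one hgcd
  have hprim : ∀ ν : Fin 2 → ℤ, Int.gcd (ν 0) (ν 1) = 1 → ν ≠ 0 ∧ latticeLength ν = 1 := by
    intro ν hν
    constructor
    · rintro rfl
      simp at hν
    · rw [latticeLength, show (Finset.univ : Finset (Fin 2)) = {0, 1} from rfl,
        Finset.gcd_insert, Finset.gcd_singleton]
      simpa [Int.gcd_def, ← gcd_eq_nat_gcd] using hν
  have hpos : (0 : ℝ) < m ^ 2 + n ^ 2 := by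
    have : m ≠ 0 ∨ n ≠ 0 := by
      by_contra! h
      simp [h.1, h.2] at hmn
    rcases this with h | h
    · have : (m : ℝ) ≠ 0 := by exact_mod_cast h
      positivity
    · have : (n : ℝ) ≠ 0 := by exact_mod_cast h
      positivity
  have horth : p * m + q * n = 0 := by
    have hg : ((Int.gcd (e 0) (e 1) : ℤ) : ℝ) ≠ 0 := by exact_mod_cast hgcd.ne'
    have h0 : (e 0 : ℝ) = m * (Int.gcd (e 0) (e 1) : ℤ) := by exact_mod_cast hm
    have h1 : (e 1 : ℝ) = n * (Int.gcd (e 0) (e 1) : ℤ) := by exact_mod_cast hn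
    simp only [planeForm_apply, toR] at hle
    apply mul_right_cancel₀ hg
    linear_combination hle - p * h0 - q * h1
  set r := (q * m - p * n) / (m ^ 2 + n ^ 2 : ℝ) with hr
  have hrD : r * (m ^ 2 + n ^ 2 : ℝ) = q * m - p * n := div_mul_cancel₀ _ hpos.ne'
  have hp : p = r * (-n) := by
    apply mul_right_cancel₀ hpos.ne'
    linear_combination n * hrD + m * horth
  have hq : q = r * m := by
    apply mul_right_cancel₀ hpos.ne'
    linear_combination -m * hrD + n * horth
  have hr0 : r ≠ 0 := by
    intro h
    apply hl
    rw [hp, hq, h]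
    ext
    simp
  rcases hr0.lt_or_gt with h | h
  · refine ⟨![n, -m], (hprim _ ?_).1, (hprim _ ?_).2, -r, neg_pos.2 h, fun x => ?_⟩
    · simpa [Int.gcd_comm] using hmn
    · simpa [Int.gcd_comm] using hmn
    · simp only [planeForm_apply, Fin.sum_univ_two, Matrix.cons_val_zero, Matrix.cons_val_one,
        Int.cast_neg]
      linear_combination x 0 * hp + x 1 * hq
  · refine ⟨![-n, m], (hprim _ ?_).1, (hprim _ ?_).2, r, h, fun x => ?_⟩
    · simpa [Int.gcd_comm] using hmn
    · simpa [Int.gcd_comm] using hmn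
    · simp only [planeForm_apply, Fin.sum_univ_two, Matrix.cons_val_zero, Matrix.cons_val_one,
        Int.cast_neg]
      linear_combination x 0 * hp + x 1 * hq

theorem exists_smul_eq_smul_of_apply_eq_zero {l : (Fin 2 → ℝ) →L[ℝ] ℝ} (hl : l ≠ 0)
    {e f : Fin 2 → ℤ} (he : e ≠ 0) (hf : f ≠ 0) (hle : l (toR e) = 0) (hlf : l (toR f) = 0) :
    ∃ s t : ℤ, s ≠ 0 ∧ t ≠ 0 ∧ s • e = t • f := by
  have hcross : e 0 * f 1 = e 1 * f 0 := by
    obtain ⟨p, q, rfl⟩ := exists_eq_planeForm l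
    simp only [planeForm_apply, toR] at hle hlf
    have hpq : p ≠ 0 ∨ q ≠ 0 := by
      by_contra! h
      exact hl (by ext; simp [h.1, h.2])
    have : (e 0 : ℝ) * f 1 = e 1 * f 0 := by
      rcases hpq with h | h
      · apply mul_left_cancel₀ h
        linear_combination f 1 * hle - e 1 * hlf
      · apply mul_left_cancel₀ h
        linear_combination -f 0 * hle + e 0 * hlf
    exact_mod_cast this
  by_cases he0 : e 0 = 0
  · have he1 : e 1 ≠ 0 := fun h => he (by ext i; fin_cases i; exacts [he0, h])
    have hf0 : f 0 = 0 := by simpa [he0, he1] using hcross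
    have hf1 : f 1 ≠ 0 := fun h => hf (by ext i; fin_cases i; exacts [hf0, h])
    refine ⟨f 1, e 1, hf1, he1, ?_⟩
    ext i
    fin_cases i
    · simp [he0, hf0]
    · simp only [Fin.mk_one, Pi.smul_apply, smul_eq_mul]
      ring
  · have hf0 : f 0 ≠ 0 := fun h => by
      have hf1 : f 1 = 0 := by simpa [he0, h] using hcross
      exact hf (by ext i; fin_cases i; exacts [h, hf1])
    refine ⟨f 0, e 0, hf0, he0, ?_⟩
    ext i
    fin_cases i
    · simp only [Fin.zero_eta, Pi.smul_apply, smul_eq_mul]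
      ring
    · simp only [Fin.mk_one, Pi.smul_apply, smul_eq_mul]
      linarith

theorem toR_sub {n : ℕ} (v w : Fin n → ℤ) : toR (v - w) = toR v - toR w := by
  ext i
  simp [toR]

/-- An edge of a plane polygon is cut out by a nonzero functional whose maximum is attained at
two or more of the generating lattice points. -/
theorem IsEdge.exists_form {S : Set (Fin 2 → ℤ)} (hfull : IsFullDim (latticeHull S))
    {a b : Fin 2 → ℤ} (h : IsEdge (latticeHull S) a b) :
    toR a ∈ latticeHull S ∧ toR b ∈ latticeHull S ∧ ∃ l : (Fin 2 → ℝ) →L[ℝ] ℝ, l ≠ 0 ∧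
      l (toR b) = l (toR a) ∧ (∀ x ∈ latticeHull S, l x ≤ l (toR a)) ∧
      {s ∈ S | l (toR s) = l (toR a)}.Nontrivial := by
  obtain ⟨hab, hexp⟩ := h
  obtain ⟨l, hl⟩ := hexp ⟨_, left_mem_segment ℝ _ _⟩
  have ha : toR a ∈ {x ∈ latticeHull S | ∀ y ∈ latticeHull S, l y ≤ l x} :=
    hl ▸ left_mem_segment ℝ _ _
  have hb : toR b ∈ {x ∈ latticeHull S | ∀ y ∈ latticeHull S, l y ≤ l x} :=
    hl ▸ right_mem_segment ℝ _ _
  have hba : l (toR b) = l (toR a) := le_antisymm (ha.2 _ hb.1) (hb.2 _ ha.1)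
  refine ⟨ha.1, hb.1, l, ?_, hba, ha.2, ?_⟩
  · rintro rfl
    set e := toR b - toR a with he
    have hne : planeForm (-(e 1)) (e 0) ≠ 0 := by
      intro h0
      have h1 := congrArg (fun f : (Fin 2 → ℝ) →L[ℝ] ℝ => f (Pi.single 0 1)) h0
      have h2 := congrArg (fun f : (Fin 2 → ℝ) →L[ℝ] ℝ => f (Pi.single 1 1)) h0
      simp at h1 h2
      apply hab
      apply toR_injective
      rw [eq_comm, ← sub_eq_zero, ← he]
      ext i
      fin_cases i
      exacts [h2, h1]
    obtain ⟨s, hs, hsa⟩ := exists_apply_ne_of_isFullDim hfull hne a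
    have hmem : toR s ∈ segment ℝ (toR a) (toR b) := by
      rw [hl]
      exact ⟨subset_convexHull ℝ _ ⟨s, hs, rfl⟩, fun y _ => le_rfl⟩
    obtain ⟨u, hu⟩ : ∃ u : ℝ, toR s = toR a + u • e := by
      rw [segment_eq_image'] at hmem
      obtain ⟨u, -, hu⟩ := hmem
      exact ⟨u, hu.symm⟩
    apply hsa
    rw [hu, map_add, map_smul]
    simp
    right
    ring
  · by_contra hnt
    rw [Set.not_nontrivial_iff] at hnt
    have hM : ∀ t ∈ toR '' S, l t ≤ l (toR a) := fun t ht => ha.2 t (subset_convexHull ℝ _ ht)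
    have hsub : {t ∈ toR '' S | l t = l (toR a)}.Subsingleton := by
      rintro _ ⟨⟨s, hs, rfl⟩, hs'⟩ _ ⟨⟨t, ht, rfl⟩, ht'⟩
      exact congrArg toR (hnt ⟨hs, hs'⟩ ⟨ht, ht'⟩)
    have hmem : ∀ x ∈ latticeHull S, l x = l (toR a) →
        x ∈ convexHull ℝ {t ∈ toR '' S | l t = l (toR a)} := fun x hx hxa =>
      (convexHull_sep_eq hM).subset ⟨hx, hxa⟩
    rw [(Set.Subsingleton.convex hsub).convexHull_eq] at hmem
    exact hab (toR_injective (hsub (hmem _ ha.1 rfl) (hmem _ hb.1 hba)))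

/-- (Key case of Proposition 3.8.) If `P₀, P₁ ⊂ ℝ²` are 2-dimensional
lattice polygons such that `P = conv((P₀ × {0}) ∪ (P₁ × {k}))` is a full-dimensional
smooth lattice polytope, then `P₀` and `P₁` have the same number of vertices, and every
edge of `P₀ × {0}` is matched with a parallel edge of `P₁ × {k}` lying in a common facet
of `P`; the matched edges share a common primitive outer normal in `ℤ²`, so `P₀` and
`P₁` are normally equivalent. -/
theorem stmt_5 (k : ℕ) (hk : 1 ≤ k) (P₀ P₁ : Set (Fin 2 → ℝ))
    (h0 : IsLatticePolytope P₀) (h1 : IsLatticePolytope P₁)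
    (h0d : IsFullDim P₀) (h1d : IsFullDim P₁)
    (hP : IsSmoothPolytope (convexHull ℝ (emb 0 '' P₀ ∪ emb (k : ℝ) '' P₁))) :
    (Set.extremePoints ℝ P₀).ncard = (Set.extremePoints ℝ P₁).ncard ∧
    ∀ a b : Fin 2 → ℤ, IsEdge P₀ a b →
      ∃ c d : Fin 2 → ℤ, IsEdge P₁ c d ∧
        (∃ s t : ℤ, s ≠ 0 ∧ t ≠ 0 ∧ s • (b - a) = t • (d - c)) ∧
        (∃ F, IsFacet (convexHull ℝ (emb 0 '' P₀ ∪ emb (k : ℝ) '' P₁)) F ∧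
          segment ℝ (emb 0 (toR a)) (emb 0 (toR b)) ⊆ F ∧
          segment ℝ (emb (k : ℝ) (toR c)) (emb (k : ℝ) (toR d)) ⊆ F) ∧
        (∃ ν : Fin 2 → ℤ, ν ≠ 0 ∧ latticeLength ν = 1 ∧
          IsCommonOuterNormal P₀ ν a b ∧ IsCommonOuterNormal P₁ ν c d) := by
  obtain ⟨S₀, rfl⟩ := h0
  obtain ⟨S₁, rfl⟩ := h1
  have hP_eq : convexHull ℝ (emb 0 '' latticeHull S₀ ∪ emb (k : ℝ) '' latticeHull S₁) =
      cayley 0 k S₀ S₁ := by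
    simpa using convexHull_emb_eq_cayley 0 k S₀ S₁
  rw [← latticeHull, ← latticeHull] at *
  rw [hP_eq] at hP ⊢
  have hk' : (0 : ℤ) ≠ k := by omega
  have hS₀ := S₀.finite_toSet
  have hS₁ := S₁.finite_toSet
  have hform : planeForm 1 0 ≠ 0 := fun h => by
    simpa using congrArg (fun f : (Fin 2 → ℝ) →L[ℝ] ℝ => f (Pi.single 0 1)) h
  have hne₀ : (S₀ : Set (Fin 2 → ℤ)).Nonempty :=
    let ⟨s, hs, _⟩ := exists_apply_ne_of_isFullDim h0d hform 0
    ⟨s, hs⟩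
  have hne₁ : (S₁ : Set (Fin 2 → ℤ)).Nonempty :=
    let ⟨s, hs, _⟩ := exists_apply_ne_of_isFullDim h1d hform 0
    ⟨s, hs⟩
  refine ⟨le_antisymm (ncard_extremePoints_le hk' hS₀ hS₁ hne₁ h1d hP)
    (ncard_extremePoints_le hk'.symm hS₁ hS₀ hne₀ h0d (cayley_comm 0 k S₀ S₁ ▸ hP)), ?_⟩
  intro a b hab
  obtain ⟨ha, hb, l, hl, hba, hmax, hnt⟩ := hab.exists_form h0d
  have hmax' : ∀ s ∈ (S₀ : Set (Fin 2 → ℤ)), l (toR s) ≤ l (toR a) := fun s hs =>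
    hmax _ (subset_convexHull ℝ _ ⟨s, hs, rfl⟩)
  obtain ⟨c, hc, d, hd, hcd, hlec, hdc, hseg⟩ :=
    exists_parallel_edge hk' hS₀ hS₁ hne₁ h1d hP hl hmax' hnt
  have hcmax : ∀ x ∈ latticeHull (S₁ : Set (Fin 2 → ℤ)), l x ≤ l (toR c) := fun x hx =>
    le_of_mem_convexHull (by rintro _ ⟨s, hs, rfl⟩; exact hlec s hs) hx
  have hba0 : l (toR (b - a)) = 0 := by rw [toR_sub, map_sub, hba, sub_self]
  have hdc0 : l (toR (d - c)) = 0 := by rw [toR_sub, map_sub, hdc, sub_self]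
  refine ⟨c, d, ⟨hcd, isExposed_segment_latticeHull hc hd hlec hdc hseg⟩,
    exists_smul_eq_smul_of_apply_eq_zero hl (sub_ne_zero.2 hab.1.symm) (sub_ne_zero.2 hcd.symm)
      hba0 hdc0, ?_, ?_⟩
  · have hk0 : (k : ℝ) ≠ 0 := by positivity
    obtain ⟨t, ht⟩ : ∃ t : ℝ, l (toR c) + t * k = l (toR a) :=
      ⟨(l (toR a) - l (toR c)) / k, by rw [div_mul_cancel₀ _ hk0]; ring⟩
    have hL : liftForm l t ≠ 0 := fun h => hl <| ContinuousLinearMap.ext fun x => by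
      simpa using congrArg (fun f : (Fin 3 → ℝ) →L[ℝ] ℝ => f (emb 0 x)) h
    have hLM : ∀ s ∈ atHeight 0 '' (S₀ : Set (Fin 2 → ℤ)) ∪ atHeight k '' (S₁ : Set (Fin 2 → ℤ)),
        liftForm l t (toR s) ≤ l (toR a) := by
      rintro _ (⟨s, hs, rfl⟩ | ⟨s, hs, rfl⟩)
      · simpa [toR_atHeight] using hmax' s hs
      · have := hlec s hs
        simp only [toR_atHeight, liftForm_emb, Int.cast_natCast]
        linarith
    have hF₀ : ∀ x ∈ latticeHull (S₀ : Set (Fin 2 → ℤ)), l x = l (toR a) →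
        emb 0 x ∈ {x ∈ cayley 0 k S₀ S₁ | liftForm l t x = l (toR a)} := fun x hx hxa =>
      ⟨hP_eq ▸ subset_convexHull ℝ _ (Or.inl ⟨x, hx, rfl⟩), by simpa using hxa⟩
    have hF₁ : ∀ x ∈ latticeHull (S₁ : Set (Fin 2 → ℤ)), l x = l (toR c) →
        emb k x ∈ {x ∈ cayley 0 k S₀ S₁ | liftForm l t x = l (toR a)} := fun x hx hxc =>
      ⟨hP_eq ▸ subset_convexHull ℝ _ (Or.inr ⟨x, hx, rfl⟩), by simpa [hxc] using ht⟩
    have hFa := hF₀ _ ha rfl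
    have hFb := hF₀ _ hb hba
    have hFc := hF₁ _ (subset_convexHull ℝ _ ⟨c, hc, rfl⟩) rfl
    have hFd := hF₁ _ (subset_convexHull ℝ _ ⟨d, hd, rfl⟩) hdc
    have hconv : Convex ℝ {x ∈ cayley 0 k S₀ S₁ | liftForm l t x = l (toR a)} :=
      (convex_convexHull ℝ _).inter (convex_hyperplane (liftForm l t).isLinear _)
    refine ⟨_, isFacet_latticeHull hL hLM hFa hFb hFc ?_,
      hconv.segment_subset hFa hFb, hconv.segment_subset hFc hFd⟩
    rw [LinearIndependent.pair_iff]
    intro p q hpq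
    have hq : q = 0 := by
      have := congrFun hpq (Fin.last 2)
      simpa [emb, Fin.snoc, hk0] using this
    refine ⟨?_, hq⟩
    by_contra hp
    apply hab.1
    ext i
    have := congrFun hpq i.castSucc
    simp only [hq, emb, Pi.add_apply, Pi.smul_apply, Pi.sub_apply, Fin.snoc_castSucc, zero_smul,
      add_zero, Pi.zero_apply, smul_eq_mul, mul_eq_zero, hp, false_or, sub_eq_zero, toR] at this
    exact_mod_cast this.symm
  · obtain ⟨ν, hν, hν1, μ, hμ, hlν⟩ :=
      exists_primitive_normal hl (sub_ne_zero.2 hab.1.symm) hba0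
    have hcomm : ∀ {Q : Set (Fin 2 → ℝ)} {v w : Fin 2 → ℤ}, (∀ x ∈ Q, l x ≤ l (toR v)) →
        l (toR w) = l (toR v) → IsCommonOuterNormal Q ν v w := by
      intro Q v w hv hwv
      constructor <;> intro x hx
      · have := hv x hx
        rw [hlν, hlν] at this
        exact le_of_mul_le_mul_left this hμ
      · have := (hv x hx).trans_eq hwv.symm
        rw [hlν, hlν] at this
        exact le_of_mul_le_mul_left this hμ
    exact ⟨ν, hν, hν1, hcomm hmax hba, hcomm hcmax hdc⟩
end

section
/- Let k ≥ 1 be an integer and let P ⊂ ℝ^n be a full-dimensional smooth lattice polytope such that every edge of P has lattice length at least k and P ⊆ {x : 0 ≤ x_n ≤ k}. Then the lattice width of P equals k. (In particular, a smooth Cayley polytope of order k all of whose edges have lattice length at least k has lattice width exactly k.) -/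
open Set

theorem latticeLength_mul_primVec {n : ℕ} (v : Fin n → ℤ) (i : Fin n) :
    (latticeLength v : ℤ) * primVec v i = v i :=
  Int.mul_ediv_cancel' (Int.natCast_dvd.2 (Finset.gcd_dvd (Finset.mem_univ i)))

theorem IsLatticePolytope.isCompact {n : ℕ} {P : Set (Fin n → ℝ)} (hP : IsLatticePolytope P) :
    IsCompact P := by
  obtain ⟨S, rfl⟩ := hP
  exact (S.finite_toSet.image toR).isCompact_convexHull (𝕜 := ℝ)

theorem IsFullDim.nonempty {n : ℕ} {P : Set (Fin n → ℝ)} (hP : IsFullDim P) : P.Nonempty := by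
  rw [← affineSpan_nonempty (k := ℝ), hP]
  exact univ_nonempty

theorem IsLatticePolytope.exists_isVertex {n : ℕ} {P : Set (Fin n → ℝ)}
    (hP : IsLatticePolytope P) (hne : P.Nonempty) : ∃ v : Fin n → ℤ, IsVertex P (toR v) := by
  obtain ⟨x, hx⟩ := hP.isCompact.extremePoints_nonempty hne
  obtain ⟨S, rfl⟩ := hP
  obtain ⟨v, -, rfl⟩ := extremePoints_convexHull_subset hx
  exact ⟨v, hx⟩

/-- A nonzero integer functional varies by at least `k` along some edge at each vertex of a
smooth polytope whose edges have lattice length at least `k`. -/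
theorem SmoothAtVertex.exists_isEdge_le_abs {n k : ℕ} {P : Set (Fin n → ℝ)} {v : Fin n → ℤ}
    (hv : SmoothAtVertex P v) (hEdge : EdgesAtLeast P k) {φ : Fin n → ℤ} (hφ : φ ≠ 0) :
    ∃ c, IsEdge P v c ∧ (k : ℤ) ≤ |∑ j, φ j * (c j - v j)| := by
  obtain ⟨b, -, hb, -, hdet⟩ := hv
  obtain ⟨i, hi⟩ : ∃ i, ∑ j, primVec (b i - v) j * φ j ≠ 0 := by
    by_contra! h
    exact hφ (Matrix.eq_zero_of_mulVec_eq_zero hdet.ne_zero (funext h))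
  refine ⟨b i, hb i, ?_⟩
  have hsum : ∑ j, φ j * (b i j - v j) =
      (latticeLength (b i - v) : ℤ) * ∑ j, primVec (b i - v) j * φ j := by
    rw [Finset.mul_sum]
    refine Finset.sum_congr rfl fun j _ => ?_
    rw [← mul_assoc, latticeLength_mul_primVec, Pi.sub_apply, mul_comm]
  rw [hsum, abs_mul, Nat.abs_cast]
  have hlen : (k : ℤ) ≤ latticeLength (b i - v) := by exact_mod_cast hEdge _ _ (hb i)
  exact hlen.trans (le_mul_of_one_le_right (Int.natCast_nonneg _) (Int.one_le_abs hi))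

theorem IsCompact.abs_sub_le_sSup_sub_sInf {α : Type*} [TopologicalSpace α] {Q : Set α}
    (hQ : IsCompact Q) {f : α → ℝ} (hf : Continuous f) {x y : α} (hx : x ∈ Q) (hy : y ∈ Q) :
    |f x - f y| ≤ sSup (f '' Q) - sInf (f '' Q) := by
  have hc := hQ.image hf
  have hxs := le_csSup hc.bddAbove (mem_image_of_mem f hx)
  have hys := le_csSup hc.bddAbove (mem_image_of_mem f hy)
  have hxi := csInf_le hc.bddBelow (mem_image_of_mem f hx)
  have hyi := csInf_le hc.bddBelow (mem_image_of_mem f hy)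
  rw [abs_le]
  constructor <;> linarith

theorem IsSmoothPolytope.le_sSup_sub_sInf {n k : ℕ} {P : Set (Fin n → ℝ)}
    (hP : IsSmoothPolytope P) (hEdge : EdgesAtLeast P k) {φ : Fin n → ℤ} (hφ : φ ≠ 0) :
    (k : ℝ) ≤ sSup ((fun x => ∑ i, (φ i : ℝ) * x i) '' P) -
      sInf ((fun x => ∑ i, (φ i : ℝ) * x i) '' P) := by
  obtain ⟨hL, hF, hS⟩ := hP
  obtain ⟨v, hv⟩ := hL.exists_isVertex hF.nonempty
  obtain ⟨c, hc, hk⟩ := (hS v hv).exists_isEdge_le_abs hEdge hφ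
  refine le_trans ?_ (hL.isCompact.abs_sub_le_sSup_sub_sInf
    (f := fun x => ∑ i, (φ i : ℝ) * x i) (by fun_prop)
    (hc.2.subset (right_mem_segment ℝ _ _)) (hc.2.subset (left_mem_segment ℝ _ _)))
  simp only [toR, ← Finset.sum_sub_distrib, ← mul_sub]
  exact_mod_cast hk

/-- A full-dimensional smooth lattice polytope all of whose edges have
lattice length at least `k ≥ 1` and which is contained in `{x : 0 ≤ xₙ ≤ k}` has
lattice width exactly `k`. -/
theorem stmt_7 {n k : ℕ} (hn : 0 < n) (hk : 1 ≤ k) (P : Set (Fin n → ℝ))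
    (hP : IsSmoothPolytope P) (hEdge : EdgesAtLeast P k)
    (hslab : ∀ x ∈ P, 0 ≤ x ⟨n - 1, by omega⟩ ∧ x ⟨n - 1, by omega⟩ ≤ (k : ℝ)) :
    latticeWidth P = k := by
  have hne := hP.2.1.nonempty
  set l : Fin n := ⟨n - 1, by omega⟩
  have hl : (Pi.single l 1 : Fin n → ℤ) ≠ 0 := by simp
  have : Nonempty {φ : Fin n → ℤ // φ ≠ 0} := ⟨⟨_, hl⟩⟩
  refine le_antisymm ?_ (le_ciInf fun φ => hP.le_sSup_sub_sInf hEdge φ.2)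
  refine (ciInf_le ⟨(k : ℝ), ?_⟩ ⟨_, hl⟩).trans ?_
  · rintro _ ⟨φ, rfl⟩
    exact hP.le_sSup_sub_sInf hEdge φ.2
  · have hcoord : (fun x : Fin n → ℝ => ∑ i, ((Pi.single l 1 : Fin n → ℤ) i : ℝ) * x i) =
        fun x => x l := by
      funext x
      simp [Pi.single_apply]
    simp only [hcoord]
    have hsup : sSup ((fun x : Fin n → ℝ => x l) '' P) ≤ k :=
      csSup_le (hne.image _) (forall_mem_image.2 fun x hx => (hslab x hx).2)
    have hinf : 0 ≤ sInf ((fun x : Fin n → ℝ => x l) '' P) :=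
      le_csInf (hne.image _) (forall_mem_image.2 fun x hx => (hslab x hx).1)
    linarith
end
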